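/- arXiv:2503.00662 — 2 statements merged into one kernel-verified Lean document; each statement's English description precedes it below -/
import Mathlib

section
/- Let S ⊂ ℤ be a finite nonempty set with S = −S and such that s+t ∉ S for all s,t ∈ ℕ∖S, let m = max(S), and let (T,μ) ∈ ŌT_m^n be a marked tree which is A_S^n-connected. (a) If 0 ∈ S, then (T,μ) ∈ ŌT_m^n(A_S^n) if and only if for every non-marked cadet edge {i,j} of T with i = s-cadet(j), one has s ∈ C_S^{end(B), start(B')}, where B and B' are the blocks of blocks(μ) containing j and i respectively. (b) If 0 ∉ S, then (T,μ) ∈ ŌT_m^n(A_S^n) if and only if for every non-marked cadet edge {i,j} with i = s-cadet(j), one has s ∈ C_S^{end(B), start(B')} and (s > 0 or |B| > 1 or |B'| > 1 or i < j), where B and B' are the blocks containing j and i respectively. -/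
open scoped BigOperators Classical

namespace Braid

/-- The hyperplane `{x ∈ ℝ^n | x i - x j = s}`. -/
def hyp (n : ℕ) (i j : Fin n) (s : ℝ) : Set (Fin n → ℝ) := {x | x i - x j = s}

/-- The arrangement `A_S^n`, as a set of hyperplanes. -/
def arrS (S : Set ℤ) (n : ℕ) : Set (Set (Fin n → ℝ)) :=
  {H | ∃ i j : Fin n, ∃ s : ℤ, i < j ∧ s ∈ S ∧ H = hyp n i j (s : ℝ)}

/-- The `m`-Catalan arrangement `A_m^n = A_{[-m;m]}^n`. -/
def catArr (m n : ℕ) : Set (Set (Fin n → ℝ)) := arrS {s : ℤ | s.natAbs ≤ m} n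

/-- `(i,j,s) ∈ Tr_m^n`. -/
def TrIdx (m n : ℕ) (i j : Fin n) (s : ℕ) : Prop := s ≤ m ∧ i ≠ j ∧ (0 < s ∨ j < i)

/-- `(i,j,s) ∈ Tr_m^n(A)`. -/
def TrIdxA (m n : ℕ) (A : Set (Set (Fin n → ℝ))) (i j : Fin n) (s : ℕ) : Prop :=
  TrIdx m n i j s ∧ hyp n i j (s : ℝ) ∈ A

/-- A transitive arrangement `A ⊆ A_m^n`. -/
def IsTransitive (m n : ℕ) (A : Set (Set (Fin n → ℝ))) : Prop :=
  ∀ i j k : Fin n, i ≠ j → j ≠ k → i ≠ k → ∀ s t : ℕ,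
    TrIdx m n i j s → TrIdx m n j k t →
    hyp n i j (s : ℝ) ∉ A → hyp n j k (t : ℝ) ∉ A → hyp n i k ((s : ℝ) + (t : ℝ)) ∉ A

/-- A strongly transitive arrangement. -/
def IsStronglyTransitive (n : ℕ) (A : Set (Set (Fin n → ℝ))) : Prop :=
  ∀ i j k : Fin n, i ≠ j → j ≠ k → i ≠ k → ∀ s t : ℕ,
    hyp n i j (s : ℝ) ∉ A → hyp n j k (t : ℝ) ∉ A → hyp n i k ((s : ℝ) + (t : ℝ)) ∉ A

/-- An `(m,n)`-tree: a rooted `(m+1)`-ary tree with `n` nodes labeled by `Fin n`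
(leaves unlabeled), encoded by the root-to-node lists of child indices. -/
structure Tree (m n : ℕ) where
  path : Fin n → List ℕ
  entry_le : ∀ v : Fin n, ∀ s ∈ path v, s ≤ m
  inj : Function.Injective path
  parent_closed : ∀ v : Fin n, path v ≠ [] → ∃ w : Fin n, path w = (path v).dropLast

namespace Tree

variable {m n : ℕ}

/-- The drift of a node. -/
def drift (T : Tree m n) (v : Fin n) : ℕ := (T.path v).sum

/-- `i = s`-child`(j)`. -/
def IsChild (T : Tree m n) (i j : Fin n) (s : ℕ) : Prop := T.path i = T.path j ++ [s]

/-- The `s`-child slot of node `j` is occupied by a node (not a leaf). -/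
def SlotNode (T : Tree m n) (j : Fin n) (s : ℕ) : Prop := ∃ i, T.IsChild i j s

/-- `i = s`-cadet`(j)`. -/
def IsCadet (T : Tree m n) (i j : Fin n) (s : ℕ) : Prop :=
  T.IsChild i j s ∧ ∀ t : ℕ, s < t → t ≤ m → ¬ T.SlotNode j t

end Tree

/-- The order `≺_T` on vertices of a tree, expressed on root-to-vertex paths:
`v ≺_T w` iff `drift(v) < drift(w)`, or the drifts are equal and there is `c ≤ k`
(`k` the length of the path of `v`) with the first `c` entries of both paths equal and
(`c = k` or the entry of the path of `v` at position `c+1` is larger than that of `w`). -/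
def vlt (p q : List ℕ) : Prop :=
  p.sum < q.sum ∨
    (p.sum = q.sum ∧ ∃ c ≤ p.length, p.take c = q.take c ∧
      (c = p.length ∨ ∃ (h1 : c < p.length) (h2 : c < q.length), q.get ⟨c, h2⟩ < p.get ⟨c, h1⟩))

/-- `p ≽_T q`. -/
def vge (p q : List ℕ) : Prop := vlt q p ∨ p = q

/-- A valid marking: `μ` is the set of (lower endpoints of) marked edges; each marked
edge is a cadet edge, and marked `0`-cadet edges `{j, 0cadet(j)}` satisfy `j < 0cadet(j)`. -/
def IsMarking {m n : ℕ} (T : Tree m n) (μ : Set (Fin n)) : Prop :=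
  ∀ i ∈ μ, ∃ j s, T.IsCadet i j s ∧ (s = 0 → (j : ℕ) < (i : ℕ))

/-- The relation `i ∼_μ j`: all edges on the tree path between `i` and `j` are marked. -/
def simMu {m n : ℕ} (T : Tree m n) (μ : Set (Fin n)) : Fin n → Fin n → Prop :=
  Relation.ReflTransGen (fun a b =>
    (a ∈ μ ∧ ∃ s, T.IsChild a b s) ∨ (b ∈ μ ∧ ∃ s, T.IsChild b a s))

/-- The block containing node `i`. -/
def blockOf {m n : ℕ} (T : Tree m n) (μ : Set (Fin n)) (i : Fin n) : Set (Fin n) :=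
  {j | simMu T μ i j}

/-- The set of blocks of a marked tree. -/
def blocksOf {m n : ℕ} (T : Tree m n) (μ : Set (Fin n)) : Set (Set (Fin n)) :=
  {B | ∃ i, B = blockOf T μ i}

/-- The block `B` is `A`-connected. -/
def BlockConnected {m n : ℕ} (A : Set (Set (Fin n → ℝ))) (T : Tree m n)
    (B : Set (Fin n)) : Prop :=
  ∀ i ∈ B, ∀ j ∈ B, Relation.ReflTransGen
    (fun a b => a ∈ B ∧ b ∈ B ∧ hyp n a b ((T.drift a : ℝ) - (T.drift b : ℝ)) ∈ A) i j

/-- The marked tree `(T,μ)` is `A`-connected. -/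
def AConnected {m n : ℕ} (A : Set (Set (Fin n → ℝ))) (T : Tree m n)
    (μ : Set (Fin n)) : Prop :=
  ∀ B ∈ blocksOf T μ, BlockConnected A T B

/-- The `A`-cadet condition. -/
def CadetCond {m n : ℕ} (A : Set (Set (Fin n → ℝ))) (T : Tree m n)
    (μ : Set (Fin n)) : Prop :=
  ∀ i j s, T.IsCadet i j s → i ∉ μ →
    ((s = 0 ∧ (i : ℕ) < (j : ℕ)) ∨
      ∃ i' j', simMu T μ i i' ∧ simMu T μ j j' ∧
        hyp n i' j' ((T.drift i' : ℝ) - (T.drift j' : ℝ)) ∈ A)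

/-- The set `ŌT_m^n` of all marked `(m,n)`-trees. -/
def OTall (m n : ℕ) : Set (Tree m n × Set (Fin n)) := {p | IsMarking p.1 p.2}

/-- The set `ŌT_m^n(A)`. -/
def OTset (m n : ℕ) (A : Set (Set (Fin n → ℝ))) : Set (Tree m n × Set (Fin n)) :=
  {p | IsMarking p.1 p.2 ∧ AConnected A p.1 p.2 ∧ CadetCond A p.1 p.2}

/-- The set `T_m^n(A)` of (unmarked) trees. -/
def Tset (m n : ℕ) (A : Set (Set (Fin n → ℝ))) : Set (Tree m n) :=
  {T | ∀ i j s, TrIdx m n i j s → hyp n i j (s : ℝ) ∉ A → ¬ T.IsCadet i j s}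

/-- The region `Φ_A(T)`. -/
def Phi (m n : ℕ) (A : Set (Set (Fin n → ℝ))) (T : Tree m n) : Set (Fin n → ℝ) :=
  {x | ∀ i j : Fin n, ∀ s : ℕ, TrIdxA m n A i j s →
        (vlt (T.path i) (T.path j ++ [s]) → x i - x j < (s : ℝ)) ∧
        (vge (T.path i) (T.path j ++ [s]) → (s : ℝ) < x i - x j)}

/-- The polyhedron `Φ̄_A(T,μ)`. -/
def PhiBar (m n : ℕ) (A : Set (Set (Fin n → ℝ))) (T : Tree m n) (μ : Set (Fin n)) :
    Set (Fin n → ℝ) :=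
  {x | (∀ i ∈ μ, ∀ j s, T.IsChild i j s → x i - x j = (s : ℝ)) ∧
       ∀ i j : Fin n, ∀ s : ℕ, TrIdxA m n A i j s → ¬ simMu T μ i j →
         (vlt (T.path i) (T.path j ++ [s]) → x i - x j < (s : ℝ)) ∧
         (vge (T.path i) (T.path j ++ [s]) → (s : ℝ) < x i - x j)}

/-- `R` is a region of `A`: a connected component of the complement of the union of `A`. -/
def IsRegion (n : ℕ) (A : Set (Set (Fin n → ℝ))) (R : Set (Fin n → ℝ)) : Prop :=
  ∃ x ∈ (⋃₀ A)ᶜ, R = connectedComponentIn (⋃₀ A)ᶜ x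

/-- `σ` is the hyperplane `H` itself or one of the two open half-spaces bounded by `H`. -/
def IsSideOf (n : ℕ) (σ H : Set (Fin n → ℝ)) : Prop :=
  σ = H ∨ ∃ (i j : Fin n) (s : ℝ), H = hyp n i j s ∧
    (σ = {x | x i - x j < s} ∨ σ = {x | s < x i - x j})

/-- `F` is a face of the arrangement `A`. -/
def IsFace (n : ℕ) (A : Set (Set (Fin n → ℝ))) (F : Set (Fin n → ℝ)) : Prop :=
  F.Nonempty ∧ ∃ σ : Set (Fin n → ℝ) → Set (Fin n → ℝ),
    (∀ H ∈ A, IsSideOf n (σ H) H) ∧ F = ⋂ H ∈ A, σ H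

/-- The dimension of (the affine hull of) a subset of `ℝ^n`. -/
noncomputable def faceDim (n : ℕ) (F : Set (Fin n → ℝ)) : ℕ :=
  Module.finrank ℝ (affineSpan ℝ F).direction

/-- The shadow of a block `B` of a marked tree:
`shadow(B) = {drift(j) - drift(a) : j ∈ B}` where `a ∈ B` is the ancestor of all of `B`. -/
def shadowOf {m n : ℕ} (T : Tree m n) (B : Set (Fin n)) : Set ℕ :=
  {d | ∃ a ∈ B, (∀ i ∈ B, T.path a <+: T.path i) ∧ ∃ j ∈ B, T.drift j = T.drift a + d}

/-- `D` is an `S`-shadow: a finite subset of `ℕ` containing `0` such that the graph on `D`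
with an edge `{i,j}` whenever `i - j ∈ S` is connected. -/
def IsShadow (S : Set ℤ) (D : Set ℕ) : Prop :=
  D.Finite ∧ 0 ∈ D ∧ ∀ i ∈ D, ∀ j ∈ D,
    Relation.ReflTransGen
      (fun a b => a ∈ D ∧ b ∈ D ∧ (((a : ℤ) - (b : ℤ)) ∈ S ∨ ((b : ℤ) - (a : ℤ)) ∈ S)) i j

/-- `start(D) = D ∩ [m-1]`. -/
def startSh (m : ℕ) (D : Set ℕ) : Set ℕ := D ∩ Set.Icc 1 (m - 1)

/-- `end(D) = (max(D) - D) ∩ [m-1]`. -/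
def endSh (m : ℕ) (D : Set ℕ) : Set ℕ := {e | ∃ d ∈ D, e + d = sSup D} ∩ Set.Icc 1 (m - 1)

/-- The connection set `C_S^{V,W}`. -/
def connSet (S : Set ℤ) (m : ℕ) (V W : Set ℕ) : Set ℕ :=
  {0} ∪ {s | 1 ≤ s ∧ s ≤ m ∧ ∃ d ∈ insert 0 V, ∃ d' ∈ insert 0 W,
    ((s : ℤ) + (d : ℤ) + (d' : ℤ)) ∈ S}
theorem hyp_mem_arrS {S : Set ℤ} {n : ℕ} (hsym : ∀ s : ℤ, s ∈ S ↔ -s ∈ S) {a b : Fin n} {x : ℤ}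
    (hab : a ≠ b) (hx : x ∈ S) : hyp n a b (x : ℝ) ∈ arrS S n := by
  rcases lt_or_gt_of_ne hab with h | h
  · exact ⟨a, b, x, h, hx, rfl⟩
  · refine ⟨b, a, -x, h, (hsym x).1 hx, ?_⟩
    ext f
    simp only [hyp, Set.mem_setOf_eq, Int.cast_neg]
    constructor <;> intro h <;> linarith

theorem of_hyp_mem_arrS {S : Set ℤ} {n : ℕ} (hsym : ∀ s : ℤ, s ∈ S ↔ -s ∈ S) {a b : Fin n} {x : ℤ}
    (hm : hyp n a b (x : ℝ) ∈ arrS S n) : a ≠ b ∧ x ∈ S := by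
  obtain ⟨p, q, s, hpq, hs, he⟩ := hm
  have h : ∀ f : Fin n → ℝ, f a - f b = x ↔ f p - f q = s := by
    intro f
    have := Set.ext_iff.1 he f
    simpa [hyp] using this
  have hqp : q ≠ p := hpq.ne'
  have h1 := (h (fun w => if w = p then (s : ℝ) else 0)).2 (by simp [hqp])
  have hab : a ≠ b := by
    rintro rfl
    have h2 := (h (fun w => if w = p then (s : ℝ) + 1 else 0)).1 (by simpa using h1)
    simp [hqp] at h2
  refine ⟨hab, ?_⟩
  have ha : a = p ∨ a = q := by
    by_contra hc
    push Not at hc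
    have h2 := (h (fun w => if w = p then (s : ℝ) else if w = a then 1 else 0)).2
      (by simp [hqp, hc.2.symm])
    simp only [hc.1, hab.symm, if_true, if_false] at h1 h2
    split_ifs at h1 h2 <;> linarith
  have hb : b = p ∨ b = q := by
    by_contra hc
    push Not at hc
    have h2 := (h (fun w => if w = p then (s : ℝ) else if w = b then 1 else 0)).2
      (by simp [hqp, hc.2.symm])
    simp only [hc.1, hab, if_true, if_false] at h1 h2
    split_ifs at h1 h2 <;> linarith
  rcases ha with rfl | rfl <;> rcases hb with rfl | rfl
  · exact absurd rfl hab
  · simp [hqp] at h1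
    have : s = x := by exact_mod_cast h1
    exact this ▸ hs
  · simp [hqp] at h1
    have : -s = x := by exact_mod_cast h1
    exact this ▸ (hsym s).1 hs
  · exact absurd rfl hab

theorem prefix_of_top {m n : ℕ} {T : Tree m n} {μ : Set (Fin n)} {i i' : Fin n} (hi : i ∉ μ)
    (h : simMu T μ i i') : T.path i <+: T.path i' := by
  induction h with
  | refl => exact List.prefix_refl _
  | @tail b c _ hbc ih =>
    rcases hbc with ⟨hb, s, hc⟩ | ⟨_, s, hc⟩
    · unfold Tree.IsChild at hc
      rw [hc, List.prefix_concat_iff] at ih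
      rcases ih with ih | ih
      · rw [← hc] at ih
        exact absurd (T.inj ih ▸ hb) hi
      · exact ih
    · unfold Tree.IsChild at hc
      rw [hc]
      exact ih.trans (List.prefix_append _ _)

theorem child_unique {m n : ℕ} {T : Tree m n} {a b c : Fin n} {s t : ℕ} (h1 : T.IsChild a b s)
    (h2 : T.IsChild a c t) : b = c ∧ s = t := by
  unfold Tree.IsChild at h1 h2
  rw [h1] at h2
  have := List.append_inj' h2 rfl
  exact ⟨T.inj this.1, by simpa using this.2⟩

theorem cadet_unique {m n : ℕ} {T : Tree m n} {a b c : Fin n} {s t : ℕ} (h1 : T.IsCadet a c s)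
    (h2 : T.IsCadet b c t) : a = b := by
  have hs : s ≤ m := T.entry_le a s (by rw [h1.1]; simp)
  have ht : t ≤ m := T.entry_le b t (by rw [h2.1]; simp)
  have e : s = t := by
    rcases lt_trichotomy s t with h | h | h
    · exact absurd ⟨b, h2.1⟩ (h1.2 t h ht)
    · exact h
    · exact absurd ⟨a, h1.1⟩ (h2.2 s h hs)
  subst e
  exact T.inj (h1.1.trans h2.1.symm)

theorem marked_cadet {m n : ℕ} {T : Tree m n} {μ : Set (Fin n)} (hμ : IsMarking T μ)
    {c b : Fin n} {s : ℕ} (hc : c ∈ μ) (h : T.IsChild c b s) : T.IsCadet c b s := by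
  obtain ⟨j, t, hj, _⟩ := hμ c hc
  obtain ⟨rfl, rfl⟩ := child_unique h hj.1
  exact hj

theorem node_of_prefix {m n : ℕ} (T : Tree m n) (l : List ℕ) :
    ∀ (r : List ℕ) (j : Fin n), T.path j = l ++ r → ∃ v, T.path v = l := by
  intro r
  induction r using List.reverseRecOn with
  | nil => intro j h; exact ⟨j, by simpa using h⟩
  | append_singleton r x ih =>
    intro j h
    obtain ⟨w, hw⟩ := T.parent_closed j (by rw [h]; simp)
    apply ih w
    rw [hw, h, ← List.append_assoc, List.dropLast_concat]

theorem prefix_of_bot {m n : ℕ} {T : Tree m n} {μ : Set (Fin n)} (hμ : IsMarking T μ)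
    {i j j' : Fin n} {s : ℕ} (hi : i ∉ μ) (hc : T.IsCadet i j s)
    (h : simMu T μ j j') : T.path j' <+: T.path j := by
  suffices T.path j' <+: T.path j ∧
      ∀ v, T.path j' <+: T.path v → v ≠ j' → T.path v <+: T.path j → v ∈ μ from this.1
  induction h with
  | refl =>
    refine ⟨List.prefix_refl _, fun v h1 h2 h3 => absurd (T.inj ?_) h2⟩
    exact h3.eq_of_length (le_antisymm h3.length_le h1.length_le)
  | @tail b c _ hbc ih =>
    obtain ⟨ih1, ih2⟩ := ih
    rcases hbc with ⟨hb, t, hch⟩ | ⟨hcm, t, hch⟩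
    · have hch' : T.path b = T.path c ++ [t] := hch
      have hcb : T.path c <+: T.path b := by rw [hch']; exact List.prefix_append _ _
      refine ⟨hcb.trans ih1, fun v h1 h2 h3 => ?_⟩
      by_cases hvb : v = b
      · exact hvb ▸ hb
      · refine ih2 v ?_ hvb h3
        apply List.prefix_of_prefix_length_le ih1 h3
        rw [hch']
        have : T.path c ≠ T.path v := fun e => h2 (T.inj e).symm
        have h4 : (T.path c).length ≠ (T.path v).length := fun e => this (h1.eq_of_length e)
        have := h1.length_le
        simp
        omega
    · have hcad := marked_cadet hμ hcm hch
      have hch' : T.path c = T.path b ++ [t] := hch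
      obtain ⟨r, hr⟩ := ih1
      cases r with
      | nil =>
        have : b = j := T.inj (by simpa using hr)
        subst this
        exact absurd (cadet_unique hcad hc ▸ hcm) hi
      | cons x r =>
        have hr' : T.path j = (T.path b ++ [x]) ++ r := by rw [← hr]; simp
        obtain ⟨v, hv⟩ := node_of_prefix T (T.path b ++ [x]) r j hr'
        have hvb : v ≠ b := by
          rintro rfl
          have := congrArg List.length hv
          simp at this
        have hvj : T.path v <+: T.path j := by rw [hr', hv]; exact List.prefix_append _ _
        have hvm : v ∈ μ := ih2 v (by rw [hv]; exact List.prefix_append _ _) hvb hvj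
        have hvc : v = c := cadet_unique (marked_cadet hμ hvm hv) hcad
        subst hvc
        refine ⟨hvj, fun w h1 h2 h3 => ih2 w ?_ ?_ h3⟩
        · exact List.IsPrefix.trans (by rw [hv]; exact List.prefix_append _ _) h1
        · rintro rfl
          have := h1.length_le
          rw [hv] at this
          simp at this

theorem drift_le_of_prefix {m n : ℕ} {T : Tree m n} {a b : Fin n} (h : T.path a <+: T.path b) :
    T.drift a ≤ T.drift b := by
  obtain ⟨r, hr⟩ := h
  unfold Tree.drift
  rw [← hr, List.sum_append]
  omega

theorem shadow_eq {m n : ℕ} {T : Tree m n} {B : Set (Fin n)} {a : Fin n} (ha : a ∈ B)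
    (hp : ∀ i ∈ B, T.path a <+: T.path i) (d : ℕ) :
    d ∈ shadowOf T B ↔ ∃ j ∈ B, T.drift j = T.drift a + d := by
  constructor
  · rintro ⟨a', ha', hp', h⟩
    have : a' = a := T.inj ((hp' a ha).eq_of_length
      (le_antisymm (hp' a ha).length_le (hp a' ha').length_le))
    subst this
    exact h
  · intro h
    exact ⟨a, ha, hp, h⟩

theorem mem_top {m n : ℕ} {T : Tree m n} {μ : Set (Fin n)} {i : Fin n} (hi : i ∉ μ) (d : ℕ) :
    d ∈ shadowOf T (blockOf T μ i) ↔ ∃ i', simMu T μ i i' ∧ T.drift i' = T.drift i + d :=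
  shadow_eq (B := blockOf T μ i) (a := i) Relation.ReflTransGen.refl
    (fun _ h => prefix_of_top hi h) d

theorem mem_bot {m n : ℕ} {T : Tree m n} {μ : Set (Fin n)} (hμ : IsMarking T μ)
    {i j : Fin n} {s : ℕ} (hi : i ∉ μ) (hc : T.IsCadet i j s) (e : ℕ) :
    (∃ d ∈ shadowOf T (blockOf T μ j), e + d = sSup (shadowOf T (blockOf T μ j))) ↔
      ∃ j', simMu T μ j j' ∧ T.drift j = T.drift j' + e := by
  have hjB : j ∈ blockOf T μ j := Relation.ReflTransGen.refl
  have hpre : ∀ k ∈ blockOf T μ j, T.path k <+: T.path j := fun k hk => prefix_of_bot hμ hi hc hk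
  obtain ⟨a, haB, hmin⟩ := Set.exists_min_image (blockOf T μ j) (fun k => (T.path k).length)
    (Set.toFinite _) ⟨j, hjB⟩
  have hap : ∀ k ∈ blockOf T μ j, T.path a <+: T.path k := fun k hk =>
    List.prefix_of_prefix_length_le (hpre a haB) (hpre k hk) (hmin k hk)
  have hsh := shadow_eq haB hap
  have haj := drift_le_of_prefix (hap j hjB)
  have hgr : IsGreatest (shadowOf T (blockOf T μ j)) (T.drift j - T.drift a) := by
    constructor
    · rw [hsh]
      exact ⟨j, hjB, by omega⟩
    · intro d hd
      rw [hsh] at hd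
      obtain ⟨k, hk, hd⟩ := hd
      have := drift_le_of_prefix (hpre k hk)
      omega
  rw [hgr.csSup_eq]
  constructor
  · rintro ⟨d, hd, he⟩
    rw [hsh] at hd
    obtain ⟨k, hk, hd⟩ := hd
    exact ⟨k, hk, by omega⟩
  · rintro ⟨k, hk, he⟩
    have := drift_le_of_prefix (hap k hk)
    exact ⟨T.drift k - T.drift a, (hsh _).2 ⟨k, hk, by omega⟩, by omega⟩

theorem cadet_drift {m n : ℕ} {T : Tree m n} {i j : Fin n} {s : ℕ} (hc : T.IsCadet i j s) :
    T.drift i = T.drift j + s := by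
  have : T.path i = T.path j ++ [s] := hc.1
  simp [Tree.drift, this]

theorem hyp_iff {S : Set ℤ} (hsym : ∀ s : ℤ, s ∈ S ↔ -s ∈ S) {m n : ℕ} {T : Tree m n}
    {a b : Fin n} : hyp n a b ((T.drift a : ℝ) - (T.drift b : ℝ)) ∈ arrS S n ↔
      a ≠ b ∧ (T.drift a : ℤ) - (T.drift b : ℤ) ∈ S := by
  have e : (T.drift a : ℝ) - (T.drift b : ℝ) = (((T.drift a : ℤ) - (T.drift b : ℤ) : ℤ) : ℝ) := by
    push_cast; rfl
  rw [e]
  exact ⟨of_hyp_mem_arrS hsym, fun h => hyp_mem_arrS hsym h.1 h.2⟩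

theorem block_ne {m n : ℕ} {T : Tree m n} {μ : Set (Fin n)} (hμ : IsMarking T μ)
    {i j i' j' : Fin n} {s : ℕ} (hi : i ∉ μ) (hc : T.IsCadet i j s)
    (h1 : simMu T μ i i') (h2 : simMu T μ j j') : i' ≠ j' := by
  rintro rfl
  have := ((prefix_of_top hi h1).trans (prefix_of_bot hμ hi hc h2)).length_le
  have h : T.path i = T.path j ++ [s] := hc.1
  rw [h] at this
  simp at this

theorem conn_pos {S : Set ℤ} (hsym : ∀ s : ℤ, s ∈ S ↔ -s ∈ S) {m n : ℕ}
    (hmax : ∀ s ∈ S, s ≤ (m : ℤ)) {T : Tree m n} {μ : Set (Fin n)} (hμ : IsMarking T μ)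
    {i j : Fin n} {s : ℕ} (hi : i ∉ μ) (hc : T.IsCadet i j s) (hs : 0 < s) :
    s ∈ connSet S m (endSh m (shadowOf T (blockOf T μ j)))
                (startSh m (shadowOf T (blockOf T μ i))) ↔
      ∃ i' j', simMu T μ i i' ∧ simMu T μ j j' ∧
        hyp n i' j' ((T.drift i' : ℝ) - (T.drift j' : ℝ)) ∈ arrS S n := by
  have hsm : s ≤ m := T.entry_le i s (by rw [hc.1]; simp)
  have hd := cadet_drift hc
  constructor
  · rintro (h | ⟨_, _, e, he, d, hd', hS⟩)
    · exact absurd h hs.ne'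
    have he' : ∃ j', simMu T μ j j' ∧ T.drift j = T.drift j' + e := by
      rcases he with rfl | he
      · exact ⟨j, Relation.ReflTransGen.refl, rfl⟩
      · exact (mem_bot hμ hi hc e).1 he.1
    have hd'' : ∃ i', simMu T μ i i' ∧ T.drift i' = T.drift i + d := by
      rcases hd' with rfl | hd'
      · exact ⟨i, Relation.ReflTransGen.refl, rfl⟩
      · exact (mem_top hi d).1 hd'.1
    obtain ⟨j', hj', hje⟩ := he'
    obtain ⟨i', hi', hie⟩ := hd''
    refine ⟨i', j', hi', hj', (hyp_iff hsym).2 ⟨block_ne hμ hi hc hi' hj', ?_⟩⟩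
    convert hS using 1
    omega
  · rintro ⟨i', j', hi', hj', h⟩
    have hS := ((hyp_iff hsym).1 h).2
    have l1 := drift_le_of_prefix (prefix_of_top hi hi')
    have l2 := drift_le_of_prefix (prefix_of_bot hμ hi hc hj')
    have hle := hmax _ hS
    refine Or.inr ⟨hs, hsm, T.drift j - T.drift j', ?_, T.drift i' - T.drift i, ?_, ?_⟩
    · by_cases h0 : T.drift j - T.drift j' = 0
      · exact Or.inl h0
      · refine Or.inr ⟨(mem_bot hμ hi hc _).2 ⟨j', hj', by omega⟩, ?_⟩
        rw [Set.mem_Icc]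
        omega
    · by_cases h0 : T.drift i' - T.drift i = 0
      · exact Or.inl h0
      · refine Or.inr ⟨(mem_top hi _).2 ⟨i', hi', by omega⟩, ?_⟩
        rw [Set.mem_Icc]
        omega
    · convert hS using 1
      omega

theorem exists_nbr {S : Set ℤ} (hsym : ∀ s : ℤ, s ∈ S ↔ -s ∈ S) {m n : ℕ} {T : Tree m n}
    {μ : Set (Fin n)} (hconn : AConnected (arrS S n) T μ) {j : Fin n}
    (h : 1 < (blockOf T μ j).ncard) :
    ∃ k, simMu T μ j k ∧ (T.drift j : ℤ) - (T.drift k : ℤ) ∈ S := by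
  have hjB : j ∈ blockOf T μ j := Relation.ReflTransGen.refl
  obtain ⟨k, hk, hkj⟩ := Set.exists_ne_of_one_lt_ncard h j
  have := hconn _ ⟨j, rfl⟩ j hjB k hk
  rcases Relation.ReflTransGen.cases_head this with h | ⟨c, ⟨_, hc, h⟩, _⟩
  · exact absurd h.symm hkj
  · exact ⟨c, hc, ((hyp_iff hsym).1 h).2⟩

theorem eq_of_ncard {α : Type*} [Finite α] {B : Set α} (h : ¬ 1 < B.ncard) {a b : α} (ha : a ∈ B)
    (hb : b ∈ B) : a = b := by
  by_contra hne
  exact h ((Set.one_lt_ncard_iff (Set.toFinite _)).2 ⟨a, b, ha, hb, hne⟩)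

/-- Lemma 5.10. Let `S ⊂ ℤ` be finite nonempty with `S = -S` and
`s+t ∉ S` for all `s,t ∈ ℕ∖S`, `m = max S`, and let `(T,μ)` be an `A_S^n`-connected marked
tree. (a) If `0 ∈ S`, then `(T,μ) ∈ ŌT_m^n(A_S^n)` iff every non-marked cadet edge `{i,j}`
with `i = s`-cadet`(j)` has `s ∈ C_S^{end(B), start(B')}` with `B, B'` the blocks of `j, i`.
(b) If `0 ∉ S`, the same with the extra condition `(s > 0 or |B| > 1 or |B'| > 1 or i < j)`. -/
theorem connection_set_cadet_condition (S : Set ℤ) (hfin : S.Finite) (hne : S.Nonempty)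
    (hsym : ∀ s : ℤ, s ∈ S ↔ -s ∈ S)
    (hclosed : ∀ s t : ℕ, (s : ℤ) ∉ S → (t : ℤ) ∉ S → ((s : ℤ) + (t : ℤ)) ∉ S)
    (m : ℕ) (hmS : (m : ℤ) ∈ S) (hmax : ∀ s ∈ S, s ≤ (m : ℤ))
    (n : ℕ) (hn : 0 < n) (T : Tree m n) (μ : Set (Fin n)) (hμ : IsMarking T μ)
    (hconn : AConnected (arrS S n) T μ) :
    ((0 : ℤ) ∈ S →
      ((T, μ) ∈ OTset m n (arrS S n) ↔
        ∀ i j s, T.IsCadet i j s → i ∉ μ →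
          s ∈ connSet S m (endSh m (shadowOf T (blockOf T μ j)))
                (startSh m (shadowOf T (blockOf T μ i))))) ∧
    ((0 : ℤ) ∉ S →
      ((T, μ) ∈ OTset m n (arrS S n) ↔
        ∀ i j s, T.IsCadet i j s → i ∉ μ →
          s ∈ connSet S m (endSh m (shadowOf T (blockOf T μ j)))
                (startSh m (shadowOf T (blockOf T μ i))) ∧
          (0 < s ∨ 1 < (blockOf T μ j).ncard ∨ 1 < (blockOf T μ i).ncard ∨
            (i : ℕ) < (j : ℕ)))) := by
  have hOT : (T, μ) ∈ OTset m n (arrS S n) ↔ CadetCond (arrS S n) T μ :=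
    ⟨fun h => h.2.2, fun h => ⟨hμ, hconn, h⟩⟩
  have hrefl : ∀ k, simMu T μ k k := fun k => Relation.ReflTransGen.refl
  constructor
  · intro h0
    rw [hOT]
    refine forall_congr' fun i => forall_congr' fun j => forall_congr' fun s =>
      forall_congr' fun hc => forall_congr' fun hi => ?_
    have hd := cadet_drift hc
    rcases Nat.eq_zero_or_pos s with rfl | hs
    · refine ⟨fun _ => Or.inl rfl, fun _ => Or.inr ⟨i, j, hrefl i, hrefl j, ?_⟩⟩
      refine (hyp_iff hsym).2 ⟨block_ne hμ hi hc (hrefl i) (hrefl j), ?_⟩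
      convert h0 using 1
      omega
    · rw [conn_pos hsym hmax hμ hi hc hs]
      exact ⟨fun h => h.resolve_left fun h => hs.ne' h.1, Or.inr⟩
  · intro h0
    rw [hOT]
    refine forall_congr' fun i => forall_congr' fun j => forall_congr' fun s =>
      forall_congr' fun hc => forall_congr' fun hi => ?_
    have hd := cadet_drift hc
    rcases Nat.eq_zero_or_pos s with rfl | hs
    · constructor
      · rintro (h | ⟨i', j', hi', hj', h⟩)
        · exact ⟨Or.inl rfl, Or.inr (Or.inr (Or.inr h.2))⟩
        · refine ⟨Or.inl rfl, Or.inr ?_⟩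
          by_contra hcon
          push Not at hcon
          have e1 : j' = j := eq_of_ncard (not_lt.2 hcon.1) hj' (hrefl j)
          have e2 : i' = i := eq_of_ncard (not_lt.2 hcon.2.1) hi' (hrefl i)
          subst e1 e2
          have hS := ((hyp_iff hsym).1 h).2
          apply h0
          convert hS using 1
          omega
      · rintro ⟨_, h | h | h | h⟩
        · exact absurd h (lt_irrefl 0)
        · obtain ⟨k, hk, hS⟩ := exists_nbr hsym hconn h
          refine Or.inr ⟨i, k, hrefl i, hk, (hyp_iff hsym).2 ⟨block_ne hμ hi hc (hrefl i) hk, ?_⟩⟩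
          convert hS using 1
          omega
        · obtain ⟨k, hk, hS⟩ := exists_nbr hsym hconn h
          refine Or.inr ⟨k, j, hk, hrefl j, (hyp_iff hsym).2 ⟨block_ne hμ hi hc hk (hrefl j), ?_⟩⟩
          rw [hsym] at hS
          convert hS using 1
          omega
        · exact Or.inl ⟨rfl, h⟩
    · rw [conn_pos hsym hmax hμ hi hc hs]
      exact ⟨fun h => ⟨h.resolve_left fun h => hs.ne' h.1, Or.inl hs⟩, fun h => Or.inr h.1⟩

end Braid
end

section
/- If a braid-type arrangement A ⊆ A_m^n is strongly transitive, then for every affine subspace L ∈ L(A), the arrangement Ã_L ⊆ ℝ^d (where d = dim L) is strongly transitive. -/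
open scoped BigOperators Classical

namespace Braid

/-- The intersection lattice `L(A)`: nonempty intersections of subfamilies of `A`
(including `ℝ^n` as the empty intersection). -/
def latt (n : ℕ) (A : Set (Set (Fin n → ℝ))) : Set (Set (Fin n → ℝ)) :=
  {L | L.Nonempty ∧ ∃ B ⊆ A, L = ⋂₀ B}

/-- `i ∼_L j`: `L` is contained in a hyperplane `{x_i - x_j = s}` for some `s ∈ ℤ`. -/
def simL (n : ℕ) (L : Set (Fin n → ℝ)) (i j : Fin n) : Prop :=
  ∃ s : ℤ, L ⊆ hyp n i j (s : ℝ)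

/-- The set `blocks(L)` of equivalence classes of `∼_L`. -/
def blocksL (n : ℕ) (L : Set (Fin n → ℝ)) : Set (Set (Fin n)) :=
  {C | ∃ i, C = {j | simL n L i j}}

/-- `i ≼_L j` (within a block of `L`): `x_i < x_j` on `L`, or `x_i = x_j` on `L`
and `i ≤ j`. -/
def precLE (n : ℕ) (L : Set (Fin n → ℝ)) (i j : Fin n) : Prop :=
  (∀ x ∈ L, x i < x j) ∨ ((∀ x ∈ L, x i = x j) ∧ i ≤ j)

/-- The arrangement `Ã_L ⊆ ℝ^d` (given the enumeration `B` of the blocks of `L` and the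
function `δ = δ_L`). -/
def Atilde (n d : ℕ) (A : Set (Set (Fin n → ℝ))) (B : Fin d → Set (Fin n))
    (δ : Fin n → ℕ) : Set (Set (Fin d → ℝ)) :=
  {H | ∃ k l : Fin d, k ≠ l ∧ ∃ i ∈ B k, ∃ j ∈ B l, ∃ s : ℤ,
    hyp n i j (s : ℝ) ∈ A ∧ H = hyp d k l ((s : ℝ) - (δ i : ℝ) + (δ j : ℝ))}
theorem hyp_swap (n : ℕ) (i j : Fin n) (s : ℝ) : hyp n i j s = hyp n j i (-s) := by
  ext x
  simp only [hyp, Set.mem_ofPred_eq]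
  constructor <;> intro h <;> linarith

theorem hyp_inj (d : ℕ) (k p k' l' : Fin d) (s c : ℝ) (hkp : k ≠ p) (hkl : k' ≠ l')
    (h : hyp d k p s = hyp d k' l' c) :
    (k' = k ∧ l' = p ∧ c = s) ∨ (k' = p ∧ l' = k ∧ c = -s) := by
  have key : ∀ x : Fin d → ℝ, x k - x p = s ↔ x k' - x l' = c := by
    intro x
    have := Set.ext_iff.1 h x
    simpa [hyp] using this
  have h0 := (key (fun v => if v = k then s else 0)).1 (by simp [hkp.symm])
  have h1 := (key (fun v => if v = k then s + 1 else if v = p then 1 else 0)).1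
    (by simp [hkp.symm])
  have h2 := (key (fun v => if v = k then s else if v = p then 0 else 1)).1
    (by simp [hkp.symm])
  have h3 := (key (fun v => (if v = k then s else 0) + (if v = k' then 1 else 0)))
  have h4 : ¬ ((if k' = k then s else 0) + (if k' = k' then (1:ℝ) else 0)
      - ((if l' = k then s else 0) + (if l' = k' then 1 else 0)) = c) := by
    simp only [hkl.symm, if_true, if_false]
    intro h
    linarith
  have h5 := fun h => h4 (h3.1 h)
  have h6 := (key (fun v => (if v = k then s else 0) + (if v = l' then 1 else 0)))
  have h7 : ¬ ((if k' = k then s else 0) + (if k' = l' then (1:ℝ) else 0)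
      - ((if l' = k then s else 0) + (if l' = l' then 1 else 0)) = c) := by
    simp only [hkl, if_true, if_false]
    intro h
    linarith
  have h8 := fun h => h7 (h6.1 h)
  have m1 : k' = k ∨ k' = p := by
    by_contra! hh
    apply h5
    simp [hkp.symm, hh.1.symm, hh.2.symm]
  have m2 : l' = k ∨ l' = p := by
    by_contra! hh
    apply h8
    simp [hkp.symm, hh.1.symm, hh.2.symm]
  rcases m1 with rfl | rfl <;> rcases m2 with rfl | rfl
  · exact absurd rfl hkl
  · left
    simp [hkl.symm] at h0
    exact ⟨rfl, rfl, h0.symm⟩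
  · right
    simp [hkl] at h0
    exact ⟨rfl, rfl, h0.symm⟩
  · exact absurd rfl hkl

theorem simL_symm {n : ℕ} {L : Set (Fin n → ℝ)} {i j : Fin n} (h : simL n L i j) :
    simL n L j i := by
  obtain ⟨s, hs⟩ := h
  refine ⟨-s, fun x hx => ?_⟩
  have := hs hx
  simp only [hyp, Set.mem_ofPred_eq] at this ⊢
  push_cast
  linarith

theorem simL_trans {n : ℕ} {L : Set (Fin n → ℝ)} {i j k : Fin n} (h : simL n L i j)
    (h' : simL n L j k) : simL n L i k := by
  obtain ⟨s, hs⟩ := h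
  obtain ⟨t, ht⟩ := h'
  refine ⟨s + t, fun x hx => ?_⟩
  have := hs hx
  have := ht hx
  simp only [hyp, Set.mem_ofPred_eq] at *
  push_cast
  linarith

/-- Lemma 6.2. If `A ⊆ A_m^n` is strongly transitive, then for every
`L ∈ L(A)` the arrangement `Ã_L ⊆ ℝ^d` (`d = dim L`) is strongly transitive. -/
theorem restriction_strongly_transitive (m n : ℕ) (hm : 0 < m) (hn : 0 < n)
    (A : Set (Set (Fin n → ℝ))) (hA : A ⊆ catArr m n)
    (hst : IsStronglyTransitive n A)
    (L : Set (Fin n → ℝ)) (hL : L ∈ latt n A)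
    (d : ℕ) (hd : faceDim n L = d)
    (B : Fin d → Set (Fin n))
    (hBmem : ∀ k, B k ∈ blocksL n L)
    (hBall : ∀ C ∈ blocksL n L, ∃! k, B k = C)
    (hBmono : StrictMono fun k => sInf {c : ℕ | ∃ v ∈ B k, (v : ℕ) = c})
    (a : Fin d → Fin n) (ha : ∀ k, a k ∈ B k ∧ ∀ j ∈ B k, precLE n L (a k) j)
    (δ : Fin n → ℕ) (hδ : ∀ k, ∀ i ∈ B k, ∀ x ∈ L, x i - x (a k) = (δ i : ℝ)) :
    IsStronglyTransitive d (Atilde n d A B δ) := by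
  have hst' : ∀ i j k : Fin n, i ≠ j → j ≠ k → i ≠ k → ∀ s t : ℤ, 0 ≤ s → 0 ≤ t →
      hyp n i k ((s + t : ℤ) : ℝ) ∈ A → hyp n i j (s : ℝ) ∈ A ∨ hyp n j k (t : ℝ) ∈ A := by
    intro i j k h1 h2 h3 s t hs ht h
    lift s to ℕ using hs
    lift t to ℕ using ht
    by_contra! hh
    refine hst i j k h1 h2 h3 s t (by simpa using hh.1) (by simpa using hh.2) ?_
    simpa using h
  have hcls : ∀ k, ∀ i ∈ B k, ∀ j, j ∈ B k ↔ simL n L i j := by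
    intro k i hi j
    obtain ⟨i0, h0⟩ := hBmem k
    rw [h0] at hi ⊢
    exact ⟨fun h => simL_trans (simL_symm hi) h, fun h => simL_trans hi h⟩
  have hdisj : ∀ k l, k ≠ l → ∀ i ∈ B k, ∀ j ∈ B l, i ≠ j := by
    rintro k l hkl i hi j hj rfl
    obtain ⟨r, -, hr⟩ := hBall {j | simL n L i j} ⟨i, rfl⟩
    apply hkl
    rw [hr k (Set.ext fun j => hcls k i hi j), hr l (Set.ext fun j => hcls l i hj j)]
  obtain ⟨⟨x0, hx0⟩, F, hFA, hLF⟩ := hL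
  have hδa : ∀ k, δ (a k) = 0 := by
    intro k
    have := hδ k (a k) (ha k).1 x0 hx0
    simp at this
    exact_mod_cast this.symm
  intro k l p hkl hlp hkp s t hs ht hH
  -- no edges between blocks
  have nkl : ∀ i ∈ B k, hyp n i (a l) ((s + δ i : ℤ) : ℝ) ∉ A := by
    intro i hi h
    refine hs ⟨k, l, hkl, i, hi, a l, (ha l).1, _, h, ?_⟩
    rw [hδa]
    congr 1
    push_cast
    ring
  have nlp : ∀ j ∈ B p, hyp n (a l) j ((t - δ j : ℤ) : ℝ) ∉ A := by
    intro j hj h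
    refine ht ⟨l, p, hlp, a l, (ha l).1, j, hj, _, h, ?_⟩
    rw [hδa]
    congr 1
    push_cast
    ring
  -- edges of `B p` do not straddle `a l`
  have nstr : ∀ u ∈ B p, ∀ w ∈ B p, δ u ≤ t → t < δ w →
      hyp n w u ((δ w - δ u : ℤ) : ℝ) ∉ A := by
    intro u hu w hw hut hwt h
    rcases hst' w (a l) u (hdisj p l hlp.symm w hw _ (ha l).1) (hdisj l p hlp _ (ha l).1 u hu)
      (by rintro rfl; omega) (δ w - t) (t - δ u) (by omega) (by omega)
      (by convert h using 3; ring) with h | h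
    · apply nlp w hw
      rw [hyp_swap]
      convert h using 2
      push_cast
      ring
    · exact nlp u hu h
  have hle : ∀ j ∈ B p, δ j ≤ t := by
    intro j hj
    by_contra! hjt
    let y : Fin n → ℝ := fun v => x0 v + if v ∈ B p ∧ δ v ≤ t then 1 else 0
    have hy : y ∈ L := by
      rw [hLF]
      intro H hH
      obtain ⟨u, w, c, huw, -, rfl⟩ := hA (hFA hH)
      have hsub : L ⊆ hyp n u w (c : ℝ) := by
        rw [hLF]
        exact Set.sInter_subset_of_mem hH
      have hx := hsub hx0
      have hsim : simL n L u w := ⟨c, hsub⟩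
      have hmem : u ∈ B p ↔ w ∈ B p :=
        ⟨fun h => (hcls p u h w).2 hsim, fun h => (hcls p w h u).2 (simL_symm hsim)⟩
      have hHA := hFA hH
      simp only [hyp, Set.mem_ofPred_eq] at hx
      have hst2 : (u ∈ B p ∧ δ u ≤ t) ↔ (w ∈ B p ∧ δ w ≤ t) := by
        by_cases hu : u ∈ B p
        · have hw := hmem.1 hu
          have e1 := hδ p u hu x0 hx0
          have e2 := hδ p w hw x0 hx0
          have e3 : (c : ℝ) = δ u - δ w := by linarith
          simp only [hu, hw, true_and]
          constructor
          · intro h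
            by_contra! h'
            apply nstr u hu w hw h h'
            rw [hyp_swap]
            convert hHA using 2
            push_cast
            linarith
          · intro h
            by_contra! h'
            apply nstr w hw u hu h h'
            convert hHA using 2
            push_cast
            linarith
        · have hw : w ∉ B p := fun h => hu (hmem.2 h)
          simp [hu, hw]
      simp only [hyp, Set.mem_ofPred_eq, y, hst2]
      linarith
    have e1 := hδ p j hj y hy
    have e2 := hδ p j hj x0 hx0
    simp only [y, hj, (ha p).1, hδa, true_and, Nat.zero_le, if_true, not_le.2 hjt, if_false] at e1
    linarith
  have final : ∀ i ∈ B k, ∀ j ∈ B p, hyp n i j ((s + t + δ i - δ j : ℤ) : ℝ) ∉ A := by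
    intro i hi j hj h
    have := hle j hj
    rcases hst' i (a l) j (hdisj k l hkl i hi _ (ha l).1) (hdisj l p hlp _ (ha l).1 j hj)
      (hdisj k p hkp i hi j hj) (s + δ i) (t - δ j) (by omega) (by omega)
      (by convert h using 3; ring) with h | h
    · exact nkl i hi h
    · exact nlp j hj h
  obtain ⟨k', l', hne, i, hi, j, hj, c, hc, he⟩ := hH
  rcases hyp_inj d k p k' l' _ _ hkp hne he with ⟨rfl, rfl, e⟩ | ⟨rfl, rfl, e⟩
  · apply final i hi j hj
    convert hc using 2
    push_cast
    linarith
  · apply final j hj i hi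
    rw [hyp_swap]
    convert hc using 2
    push_cast
    linarith

end Braid
end
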